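/- For every λ > 0, every 0 < λ ≤ 1 and every natural number n, the n-th moment of the absolutely continuous measure with density x ↦ √(4 − (x − λ)²)/(2π(λx + 1)) on [λ − 2, λ + 2] equals the λ-weighted Riordan count: ∫_{λ−2}^{λ+2} x^n · √(4 − (x − λ)²)/(2π(λx + 1)) dx = b_{1,n}(λ). -/

import Mathlib

open MeasureTheory

/-- A Motzkin path of size `u.length`, encoded as a word over `Fin 3`
(`0` = up-step `a`, `1` = down-step `b`, `2` = level-step `c`):
every prefix has at least as many up-steps as down-steps, and
the full word has equally many up-steps and down-steps. -/
def IsMotzkin (u : List (Fin 3)) : Prop :=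
  (∀ j : ℕ, (u.take j).count 1 ≤ (u.take j).count 0) ∧ u.count 0 = u.count 1

/-- A Riordan path: a Motzkin path with no level-step at height `0`. -/
def IsRiordan (u : List (Fin 3)) : Prop :=
  IsMotzkin u ∧
    ∀ j : Fin u.length, u.get j = 2 → (u.take j).count 1 < (u.take j).count 0

-- `bOne lam n = b_{1,n}(λ) = Σ_{u ∈ 𝓡(n)} λ^{|u|_c}`, the λ-weighted count of
-- Riordan paths of size `n` (words of length `n` encoded by functions `Fin n → Fin 3`).
open Classical in
noncomputable def bOne (lam : ℝ) (n : ℕ) : ℝ :=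
  ∑ f : Fin n → Fin 3,
    if IsRiordan (List.ofFn f) then lam ^ ((List.ofFn f).count 2) else 0

/-- A word that stays nonnegative when started at height `h`, ends at height `0`, and has no
level-step at height `0`. -/
def IsRiordanFrom (h : ℕ) (u : List (Fin 3)) : Prop :=
  (∀ j : ℕ, (u.take j).count 1 ≤ h + (u.take j).count 0) ∧ h + u.count 0 = u.count 1 ∧
    ∀ j : ℕ, u[j]? = some 2 → (u.take j).count 1 < h + (u.take j).count 0

lemma isRiordan_iff_isRiordanFrom_zero (u : List (Fin 3)) : IsRiordan u ↔ IsRiordanFrom 0 u := by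
  unfold IsRiordan IsMotzkin IsRiordanFrom
  simp only [Nat.zero_add, and_assoc]
  refine and_congr_right fun _ => and_congr_right fun _ => ⟨fun H j hj => ?_, fun H j hj => ?_⟩
  · obtain ⟨hlt, hj'⟩ := List.getElem?_eq_some_iff.1 hj
    exact H ⟨j, hlt⟩ hj'
  · exact H j (List.getElem?_eq_some_iff.2 ⟨j.2, hj⟩)

lemma forall_nat_iff {P : ℕ → Prop} : (∀ j, P j) ↔ P 0 ∧ ∀ j, P (j + 1) :=
  ⟨fun H => ⟨H 0, fun j => H (j + 1)⟩, fun H j => by cases j with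
    | zero => exact H.1
    | succ j => exact H.2 j⟩

lemma isRiordanFrom_nil (h : ℕ) : IsRiordanFrom h [] ↔ h = 0 := by
  simp [IsRiordanFrom]

lemma isRiordanFrom_up (h : ℕ) (u : List (Fin 3)) :
    IsRiordanFrom h (0 :: u) ↔ IsRiordanFrom (h + 1) u := by
  unfold IsRiordanFrom
  rw [forall_nat_iff, forall_nat_iff (P := fun j => (0 :: u)[j]? = some 2 → _)]
  simp [Nat.add_assoc, Nat.add_comm]

lemma isRiordanFrom_zero_down (u : List (Fin 3)) : ¬ IsRiordanFrom 0 (1 :: u) := fun H => by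
  simpa using H.1 1

lemma isRiordanFrom_succ_down (h : ℕ) (u : List (Fin 3)) :
    IsRiordanFrom (h + 1) (1 :: u) ↔ IsRiordanFrom h u := by
  unfold IsRiordanFrom
  rw [forall_nat_iff, forall_nat_iff (P := fun j => (1 :: u)[j]? = some 2 → _)]
  simp only [List.take_zero, List.count_nil, List.take_succ_cons, List.count_cons,
    List.getElem?_cons_succ, List.getElem?_cons_zero]
  simp only [beq_self_eq_true, if_true, Nat.zero_le, true_and, Nat.add_zero, Nat.zero_lt_succ,
    implies_true, show ((1 : Fin 3) == 0) = false from rfl, Bool.false_eq_true, if_false]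
  refine and_congr (forall_congr' fun j => by omega) (and_congr (by omega)
    (forall_congr' fun j => imp_congr_right fun _ => by omega))

lemma isRiordanFrom_zero_level (u : List (Fin 3)) : ¬ IsRiordanFrom 0 (2 :: u) := fun H => by
  simpa using H.2.2 0

lemma isRiordanFrom_succ_level (h : ℕ) (u : List (Fin 3)) :
    IsRiordanFrom (h + 1) (2 :: u) ↔ IsRiordanFrom (h + 1) u := by
  unfold IsRiordanFrom
  rw [forall_nat_iff, forall_nat_iff (P := fun j => (2 :: u)[j]? = some 2 → _)]
  simp

open Classical in
/-- The weight `λ ^ |u|_c` of a Riordan word started at height `h`, and `0` for other words. -/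
noncomputable def riordanWeight (lam : ℝ) (h : ℕ) (u : List (Fin 3)) : ℝ :=
  if IsRiordanFrom h u then lam ^ u.count 2 else 0

open Classical in
lemma riordanWeight_up (lam : ℝ) (h : ℕ) (u : List (Fin 3)) :
    riordanWeight lam h (0 :: u) = riordanWeight lam (h + 1) u :=
  if_congr (isRiordanFrom_up h u) (by simp) rfl

lemma riordanWeight_zero_down (lam : ℝ) (u : List (Fin 3)) : riordanWeight lam 0 (1 :: u) = 0 :=
  if_neg (isRiordanFrom_zero_down u)

open Classical in
lemma riordanWeight_succ_down (lam : ℝ) (h : ℕ) (u : List (Fin 3)) :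
    riordanWeight lam (h + 1) (1 :: u) = riordanWeight lam h u :=
  if_congr (isRiordanFrom_succ_down h u) (by simp) rfl

lemma riordanWeight_zero_level (lam : ℝ) (u : List (Fin 3)) : riordanWeight lam 0 (2 :: u) = 0 :=
  if_neg (isRiordanFrom_zero_level u)

open Classical in
lemma riordanWeight_succ_level (lam : ℝ) (h : ℕ) (u : List (Fin 3)) :
    riordanWeight lam (h + 1) (2 :: u) = lam * riordanWeight lam (h + 1) u := by
  unfold riordanWeight
  rw [mul_ite, mul_zero]
  exact if_congr (isRiordanFrom_succ_level h u) (by simp [pow_succ']) rfl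

/-- The weighted count of Riordan words of size `n` started at height `h`. -/
noncomputable def riordanSum (lam : ℝ) (n h : ℕ) : ℝ :=
  ∑ f : Fin n → Fin 3, riordanWeight lam h (List.ofFn f)

open Classical in
lemma bOne_eq_riordanSum (lam : ℝ) (n : ℕ) : bOne lam n = riordanSum lam n 0 :=
  Finset.sum_congr rfl fun _ _ => if_congr (isRiordan_iff_isRiordanFrom_zero _) rfl rfl

lemma riordanSum_zero_left (lam : ℝ) (h : ℕ) :
    riordanSum lam 0 h = if h = 0 then 1 else 0 := by
  simp [riordanSum, riordanWeight, isRiordanFrom_nil]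

lemma riordanSum_succ_left (lam : ℝ) (n h : ℕ) :
    riordanSum lam (n + 1) h =
      ∑ a : Fin 3, ∑ f : Fin n → Fin 3, riordanWeight lam h (a :: List.ofFn f) := by
  rw [riordanSum, ← (Fin.consEquiv fun _ => Fin 3).sum_comp, Fintype.sum_prod_type]
  simp [Fin.consEquiv, List.ofFn_succ]

lemma riordanSum_succ_zero (lam : ℝ) (n : ℕ) :
    riordanSum lam (n + 1) 0 = riordanSum lam n 1 := by
  rw [riordanSum_succ_left]
  simp [Fin.sum_univ_three, riordanWeight_up, riordanWeight_zero_down, riordanWeight_zero_level,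
    riordanSum]

lemma riordanSum_succ_succ (lam : ℝ) (n h : ℕ) :
    riordanSum lam (n + 1) (h + 1) =
      riordanSum lam n (h + 2) + lam * riordanSum lam n (h + 1) + riordanSum lam n h := by
  rw [riordanSum_succ_left]
  simp only [Fin.sum_univ_three, riordanWeight_up, riordanWeight_succ_down,
    riordanWeight_succ_level, ← Finset.mul_sum, riordanSum]
  ring

/-- The orthogonal polynomials `p₀ = 1`, `p₁ = x`, `pₕ₊₂ = (x - λ) pₕ₊₁ - pₕ`. -/
def riordanPoly (lam x : ℝ) : ℕ → ℝ
  | 0 => 1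
  | 1 => x
  | h + 2 => (x - lam) * riordanPoly lam x (h + 1) - riordanPoly lam x h

lemma continuous_riordanPoly (lam : ℝ) (h : ℕ) : Continuous fun x => riordanPoly lam x h := by
  induction h using Nat.twoStepInduction with
  | zero => simpa [riordanPoly] using continuous_const
  | one => simpa only [riordanPoly] using continuous_id'
  | more h h₀ h₁ =>
    simp only [riordanPoly]
    fun_prop

lemma riordanPoly_mul_sin (lam t : ℝ) (h : ℕ) :
    riordanPoly lam (lam + 2 * Real.cos t) h * Real.sin t =
      Real.sin ((h + 1) * t) + lam * Real.sin (h * t) := by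
  induction h using Nat.twoStepInduction with
  | zero => simp [riordanPoly]
  | one =>
    have : Real.sin ((1 + 1) * t) = 2 * Real.sin t * Real.cos t := by
      rw [← Real.sin_two_mul]; norm_num
    simp only [riordanPoly, Nat.cast_one, this, one_mul]
    ring
  | more h h₀ h₁ =>
    have key : ∀ s : ℝ, Real.sin (s + t + t) =
        2 * Real.cos t * Real.sin (s + t) - Real.sin s := fun s => by
      have e : Real.sin s = Real.sin (s + t - t) := by rw [add_sub_cancel_right]
      rw [e, Real.sin_add (s + t), Real.sin_sub]
      ring
    have e₁ := key (h * t)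
    have e₂ := key ((h + 1) * t)
    push_cast at h₀ h₁ ⊢
    simp only [riordanPoly]
    rw [show ((h : ℝ) + 2 + 1) * t = (h + 1) * t + t + t by ring,
      show ((h : ℝ) + 2) * t = h * t + t + t by ring, e₁, e₂,
      show (h : ℝ) * t + t = (h + 1) * t by ring,
      show ((h : ℝ) + 1) * t + t = (h + 1 + 1) * t by ring]
    linear_combination 2 * Real.cos t * h₁ - h₀

/-- The density in the angular variable `x = λ + 2 cos t`. -/
noncomputable def angularDensity (lam t : ℝ) : ℝ :=
  2 / Real.pi * (Real.sin t ^ 2 / (lam * (lam + 2 * Real.cos t) + 1))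

lemma sin_sq_le_denom (lam t : ℝ) :
    Real.sin t ^ 2 ≤ lam * (lam + 2 * Real.cos t) + 1 := by
  nlinarith [Real.sin_sq_add_cos_sq t, sq_nonneg (lam + Real.cos t)]

lemma intervalIntegrable_angularDensity_mul (lam : ℝ) {f : ℝ → ℝ} (hf : Continuous f) (a b : ℝ) :
    IntervalIntegrable (fun t => angularDensity lam t * f t) volume a b := by
  have hW : IntervalIntegrable (angularDensity lam) volume a b := by
    refine (intervalIntegrable_const (c := 2 / Real.pi)).mono_fun ?_ ?_
    · unfold angularDensity
      exact Measurable.aestronglyMeasurable (by fun_prop)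
    · refine Filter.Eventually.of_forall fun t => ?_
      have h0 := sin_sq_le_denom lam t
      have h1 : 0 ≤ lam * (lam + 2 * Real.cos t) + 1 := (sq_nonneg _).trans h0
      simp only [angularDensity, norm_mul]
      refine mul_le_of_le_one_right (norm_nonneg _) ?_
      rw [Real.norm_of_nonneg (by positivity)]
      exact div_le_one_of_le₀ h0 h1
  exact hW.mul_continuousOn hf.continuousOn

lemma integral_eq_integral_angularDensity (lam : ℝ) (n : ℕ) :
    (∫ x in (lam - 2)..(lam + 2),
        x ^ n * (Real.sqrt (4 - (x - lam) ^ 2) / (2 * Real.pi * (lam * x + 1)))) =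
      ∫ t in (0)..Real.pi, angularDensity lam t * (lam + 2 * Real.cos t) ^ n := by
  have himg : (fun t => lam + 2 * Real.cos t) '' Set.Icc 0 Real.pi =
      Set.Icc (lam - 2) (lam + 2) := by
    have : (fun t => lam + 2 * Real.cos t) = (fun y => lam + 2 * y) ∘ Real.cos := rfl
    rw [this, Set.image_comp, Real.bijOn_cos.image_eq]
    ext x
    simp only [Set.mem_image, Set.mem_Icc]
    refine ⟨?_, fun hx => ⟨(x - lam) / 2, ⟨by linarith, by linarith⟩, by ring⟩⟩
    rintro ⟨y, hy, rfl⟩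
    constructor <;> linarith
  rw [intervalIntegral.integral_of_le (by linarith), intervalIntegral.integral_of_le Real.pi_pos.le,
    ← integral_Icc_eq_integral_Ioc, ← integral_Icc_eq_integral_Ioc, ← himg,
    integral_image_eq_integral_abs_deriv_smul (f' := fun t => 2 * -Real.sin t) measurableSet_Icc
      (fun t _ => (((Real.hasDerivAt_cos t).const_mul 2).const_add lam).hasDerivWithinAt)]
  · refine setIntegral_congr_fun measurableSet_Icc fun t ht => ?_
    have hs : 0 ≤ Real.sin t := Real.sin_nonneg_of_mem_Icc ht
    have hsq : 4 - (lam + 2 * Real.cos t - lam) ^ 2 = (2 * Real.sin t) ^ 2 := by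
      nlinarith [Real.sin_sq_add_cos_sq t]
    have habs : |2 * -Real.sin t| = 2 * Real.sin t := by
      rw [mul_neg, abs_neg, abs_of_nonneg (by positivity)]
    simp only [habs, hsq, Real.sqrt_sq (mul_nonneg two_pos.le hs), smul_eq_mul, angularDensity,
      div_eq_mul_inv, mul_inv]
    ring
  · intro s hs t ht hst
    exact Real.injOn_cos hs ht (by simpa using hst)

/-- The integral of the `h`-th orthogonal polynomial against the `n`-th power. -/
noncomputable def riordanMoment (lam : ℝ) (n h : ℕ) : ℝ :=
  ∫ t in (0)..Real.pi, angularDensity lam t *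
    ((lam + 2 * Real.cos t) ^ n * riordanPoly lam (lam + 2 * Real.cos t) h)

lemma continuous_pow_mul_riordanPoly (lam : ℝ) (n h : ℕ) :
    Continuous fun t =>
      (lam + 2 * Real.cos t) ^ n * riordanPoly lam (lam + 2 * Real.cos t) h := by
  have := (continuous_riordanPoly lam h).comp
    (show Continuous fun t => lam + 2 * Real.cos t by fun_prop)
  exact (by fun_prop : Continuous fun t => (lam + 2 * Real.cos t) ^ n).mul this

lemma intervalIntegrable_riordanMoment (lam : ℝ) (n h : ℕ) :
    IntervalIntegrable (fun t => angularDensity lam t *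
      ((lam + 2 * Real.cos t) ^ n * riordanPoly lam (lam + 2 * Real.cos t) h))
      volume 0 Real.pi :=
  intervalIntegrable_angularDensity_mul lam (continuous_pow_mul_riordanPoly lam n h) _ _

lemma riordanMoment_succ_zero (lam : ℝ) (n : ℕ) :
    riordanMoment lam (n + 1) 0 = riordanMoment lam n 1 := by
  simp [riordanMoment, riordanPoly, pow_succ]

lemma riordanMoment_succ_succ (lam : ℝ) (n h : ℕ) :
    riordanMoment lam (n + 1) (h + 1) =
      riordanMoment lam n (h + 2) + lam * riordanMoment lam n (h + 1) + riordanMoment lam n h := by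
  unfold riordanMoment
  have i₀ := intervalIntegrable_riordanMoment lam n h
  have i₁ := intervalIntegrable_riordanMoment lam n (h + 1)
  have i₂ := intervalIntegrable_riordanMoment lam n (h + 2)
  rw [← intervalIntegral.integral_const_mul, ← intervalIntegral.integral_add i₂ (i₁.const_mul lam),
    ← intervalIntegral.integral_add (i₂.add (i₁.const_mul lam)) i₀]
  refine intervalIntegral.integral_congr fun t _ => ?_
  simp only [riordanPoly]
  ring

lemma integral_cos_nat_mul (k : ℕ) :
    ∫ t in (0)..Real.pi, Real.cos (k * t) = if k = 0 then Real.pi else 0 := by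
  rcases eq_or_ne k 0 with rfl | hk
  · simp
  · have hk' : (k : ℝ) ≠ 0 := Nat.cast_ne_zero.2 hk
    rw [intervalIntegral.integral_comp_mul_left (fun t => Real.cos t) hk']
    simp [hk]

lemma integral_sin_mul_sin (h : ℕ) :
    ∫ t in (0)..Real.pi, 2 / Real.pi * (Real.sin t * Real.sin ((h + 1) * t)) =
      if h = 0 then 1 else 0 := by
  have e : ∀ t : ℝ, 2 / Real.pi * (Real.sin t * Real.sin ((h + 1) * t)) =
      1 / Real.pi * (Real.cos ((h : ℕ) * t) - Real.cos ((h + 2 : ℕ) * t)) := fun t => by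
    push_cast
    rw [show (h : ℝ) * t = (h + 1) * t - t by ring, show ((h : ℝ) + 2) * t = (h + 1) * t + t by ring,
      Real.cos_add, Real.cos_sub]
    ring
  simp only [e]
  rw [intervalIntegral.integral_const_mul, intervalIntegral.integral_sub
    (Continuous.intervalIntegrable (by fun_prop) _ _)
    (Continuous.intervalIntegrable (by fun_prop) _ _), integral_cos_nat_mul, integral_cos_nat_mul]
  split_ifs <;> simp_all [Real.pi_ne_zero]

lemma angularDensity_mul_riordanPoly (lam t : ℝ) (h : ℕ) :
    angularDensity lam t * riordanPoly lam (lam + 2 * Real.cos t) h =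
      2 / Real.pi * (Real.sin t * (Real.sin ((h + 1) * t) + lam * Real.sin (h * t)) /
        (lam * (lam + 2 * Real.cos t) + 1)) := by
  rw [← riordanPoly_mul_sin, angularDensity]
  ring

lemma riordanMoment_zero_add (lam : ℝ) (h : ℕ) :
    riordanMoment lam 0 h + lam * riordanMoment lam 0 (h + 1) = if h = 0 then 1 else 0 := by
  rw [← integral_sin_mul_sin h]
  unfold riordanMoment
  rw [← intervalIntegral.integral_const_mul, ← intervalIntegral.integral_add
    (intervalIntegrable_riordanMoment lam 0 h)
    ((intervalIntegrable_riordanMoment lam 0 (h + 1)).const_mul lam)]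
  refine intervalIntegral.integral_congr fun t _ => ?_
  simp only [pow_zero, one_mul, angularDensity_mul_riordanPoly]
  have hD := sin_sq_le_denom lam t
  rcases eq_or_ne (lam * (lam + 2 * Real.cos t) + 1) 0 with h0 | h0
  · have : Real.sin t = 0 := by
      rw [h0] at hD
      exact pow_eq_zero_iff two_ne_zero |>.1 (le_antisymm hD (sq_nonneg _))
    simp [this]
  · have e : Real.sin (((h + 1 : ℕ) + 1) * t) =
        2 * Real.cos t * Real.sin ((h + 1) * t) - Real.sin (h * t) := by
      push_cast
      rw [show (h : ℝ) * t = (h + 1) * t - t by ring,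
        show ((h : ℝ) + 1 + 1) * t = (h + 1) * t + t by ring, Real.sin_add, Real.sin_sub]
      ring
    rw [e]
    push_cast
    field_simp
    ring

lemma riordanMoment_zero_one_of_lt_one {lam : ℝ} (hpos : 0 < lam) (hlt : lam < 1) :
    riordanMoment lam 0 1 = 0 := by
  have hgeom : ∀ h : ℕ, riordanMoment lam 0 1 = (-lam) ^ h * riordanMoment lam 0 (h + 1) := by
    intro h
    induction h with
    | zero => simp
    | succ h ih =>
      have := riordanMoment_zero_add lam (h + 1)
      rw [if_neg h.succ_ne_zero] at this
      rw [ih]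
      linear_combination (-lam) ^ h * this
  have hpi := Real.pi_pos
  set C : ℝ := 2 / Real.pi * (2 / (1 - lam) ^ 2) * |Real.pi - 0| with hC
  have hbound : ∀ h : ℕ, |riordanMoment lam 0 h| ≤ C := by
    intro h
    rw [riordanMoment, ← Real.norm_eq_abs]
    refine intervalIntegral.norm_integral_le_of_norm_le_const fun t _ => ?_
    have hD : (1 - lam) ^ 2 ≤ lam * (lam + 2 * Real.cos t) + 1 := by
      nlinarith [Real.neg_one_le_cos t]
    have hD0 : 0 < (1 - lam) ^ 2 := by
      have : 0 < 1 - lam := by linarith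
      positivity
    rw [pow_zero, one_mul, angularDensity_mul_riordanPoly, norm_mul,
      Real.norm_of_nonneg (by positivity : 0 ≤ 2 / Real.pi)]
    refine mul_le_mul_of_nonneg_left ?_ (by positivity)
    rw [norm_div, Real.norm_of_nonneg (hD0.le.trans hD)]
    refine div_le_div₀ two_pos.le ?_ hD0 hD
    have h₁ := Real.abs_sin_le_one t
    have h₂ : |Real.sin ((h + 1) * t) + lam * Real.sin (h * t)| ≤ 2 := by
      refine (abs_add_le _ _).trans ?_
      rw [abs_mul, abs_of_pos hpos]
      nlinarith [Real.abs_sin_le_one ((h + 1) * t), Real.abs_sin_le_one (h * t),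
        abs_nonneg (Real.sin (h * t))]
    rw [Real.norm_eq_abs, abs_mul]
    nlinarith [abs_nonneg (Real.sin t),
      abs_nonneg (Real.sin ((h + 1) * t) + lam * Real.sin (h * t))]
  have hlim : Filter.Tendsto (fun h : ℕ => lam ^ h * C) Filter.atTop (nhds 0) := by
    simpa using (tendsto_pow_atTop_nhds_zero_of_lt_one hpos.le hlt).mul_const C
  refine abs_nonpos_iff.1 (ge_of_tendsto' hlim fun h => ?_)
  rw [hgeom h, abs_mul, abs_pow, abs_neg, abs_of_pos hpos]
  exact mul_le_mul_of_nonneg_left (hbound _) (by positivity)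

lemma riordanMoment_one_zero_zero : riordanMoment 1 0 0 = 1 := by
  have hae : ∀ t ∈ Set.Ioo 0 Real.pi, angularDensity 1 t *
      ((1 + 2 * Real.cos t) ^ 0 * riordanPoly 1 (1 + 2 * Real.cos t) 0) =
        1 / Real.pi * (1 - Real.cos t) := by
    intro t ht
    have hs : 0 < Real.sin t := Real.sin_pos_of_mem_Ioo ht
    have hc : 1 + Real.cos t ≠ 0 := by
      intro hc
      nlinarith [Real.sin_sq_add_cos_sq t]
    have hs2 : Real.sin t ^ 2 = (1 - Real.cos t) * (1 + Real.cos t) := by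
      linear_combination Real.sin_sq_add_cos_sq t
    rw [angularDensity, hs2, show 1 * (1 + 2 * Real.cos t) + 1 = 2 * (1 + Real.cos t) by ring]
    simp only [riordanPoly]
    field_simp
  have hpi := Real.pi_ne_zero
  rw [riordanMoment, intervalIntegral.integral_of_le Real.pi_pos.le, integral_Ioc_eq_integral_Ioo,
    setIntegral_congr_fun measurableSet_Ioo hae, ← integral_Ioc_eq_integral_Ioo,
    ← intervalIntegral.integral_of_le Real.pi_pos.le, intervalIntegral.integral_const_mul,
    intervalIntegral.integral_sub (by simp) (Real.continuous_cos.intervalIntegrable _ _)]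
  simp [hpi]

lemma riordanMoment_zero_left {lam : ℝ} (hpos : 0 < lam) (hle : lam ≤ 1) (h : ℕ) :
    riordanMoment lam 0 h = if h = 0 then 1 else 0 := by
  have h01 := riordanMoment_zero_add lam 0
  simp only [if_true, zero_add] at h01
  have h0 : riordanMoment lam 0 0 = 1 := by
    rcases hle.lt_or_eq with hlt | rfl
    · simpa [riordanMoment_zero_one_of_lt_one hpos hlt] using h01
    · exact riordanMoment_one_zero_zero
  induction h with
  | zero => simpa using h0
  | succ h ih =>
    have := riordanMoment_zero_add lam h
    rw [ih] at this
    simpa [hpos.ne'] using this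

lemma riordanMoment_eq_riordanSum {lam : ℝ} (hpos : 0 < lam) (hle : lam ≤ 1) (n h : ℕ) :
    riordanMoment lam n h = riordanSum lam n h := by
  induction n generalizing h with
  | zero => rw [riordanMoment_zero_left hpos hle, riordanSum_zero_left]
  | succ n ih =>
    cases h with
    | zero => rw [riordanMoment_succ_zero, riordanSum_succ_zero, ih]
    | succ h => rw [riordanMoment_succ_succ, riordanSum_succ_succ, ih, ih, ih]

theorem stmt0 (lam : ℝ) (hpos : 0 < lam) (hle : lam ≤ 1) (n : ℕ) :
    (∫ x in (lam - 2)..(lam + 2),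
        x ^ n * (Real.sqrt (4 - (x - lam) ^ 2) / (2 * Real.pi * (lam * x + 1))))
      = bOne lam n := by
  rw [integral_eq_integral_angularDensity, bOne_eq_riordanSum,
    ← riordanMoment_eq_riordanSum hpos hle, riordanMoment]
  simp [riordanPoly]
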